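/- arXiv:2508.08212 — 3 statements merged into one kernel-verified Lean document; each statement's English description precedes it below -/
import Mathlib

section
/- Let γ : ℝ → ℝ be monotone nondecreasing and right-continuous. Then the pushforward under γ of the Lebesgue–Stieltjes measure μ_γ restricted to the continuity set D_γ equals Lebesgue measure restricted to the range of γ: γ_#(μ_γ ↾ D_γ) = λ ↾ range(γ). -/
open MeasureTheory

lemma gal_aux (γ : StieltjesFunction ℝ) (y : ℝ) (h1 : ∃ a, γ a < y) (h2 : ∃ b, y ≤ γ b) (t : ℝ) :
    sInf {t | y ≤ γ t} ≤ t ↔ y ≤ γ t := by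
  obtain ⟨a, ha⟩ := h1
  have hb : BddBelow {t | y ≤ γ t} := by
    refine ⟨a, fun s hs => ?_⟩
    by_contra hlt
    exact absurd (hs.trans (γ.mono (not_le.1 hlt).le)) (not_le.2 ha)
  refine ⟨fun h => ?_, fun h => csInf_le hb h⟩
  refine le_trans ?_ (γ.mono h)
  have hr := (γ.right_continuous (sInf {t | y ≤ γ t})).mono Set.Ioi_subset_Ici_self
  refine ge_of_tendsto hr ?_
  filter_upwards [self_mem_nhdsWithin] with s hs
  obtain ⟨u, hu, hus⟩ := exists_lt_of_csInf_lt h2 hs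
  exact le_trans hu (γ.mono hus.le)

lemma measure_eq_aux (γ : StieltjesFunction ℝ) (g : ℝ → ℝ) (J : Set ℝ)
    (hJ : J = {y | (∃ a, γ a < y) ∧ ∃ b, y ≤ γ b})
    (hJm : MeasurableSet J)
    (hg : ∀ y ∈ J, ∀ t, g y ≤ t ↔ y ≤ γ t) (hgm : AEMeasurable g (volume.restrict J)) :
    γ.measure = Measure.map g (volume.restrict J) := by
  refine Measure.ext_of_Ioc _ _ fun a b hab => ?_
  rw [γ.measure_Ioc, Measure.map_apply_of_aemeasurable hgm measurableSet_Ioc,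
    Measure.restrict_apply' hJm, ← Real.volume_Ioc]
  congr 1
  ext y
  simp only [Set.mem_Ioc, Set.mem_inter_iff, Set.mem_preimage]
  constructor
  · rintro ⟨h1, h2⟩
    have hy : y ∈ J := by rw [hJ]; exact ⟨⟨a, h1⟩, ⟨b, h2⟩⟩
    exact ⟨⟨not_le.1 fun h => absurd ((hg y hy a).1 h) (not_le.2 h1), (hg y hy b).2 h2⟩, hy⟩
  · rintro ⟨⟨h1, h2⟩, hy⟩
    exact ⟨not_le.1 fun h => absurd ((hg y hy a).2 h) (not_le.2 h1), (hg y hy b).1 h2⟩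

/-- For a monotone nondecreasing right-continuous `γ : ℝ → ℝ` (i.e. a Stieltjes function),
the pushforward under `γ` of its Lebesgue–Stieltjes measure restricted to the set of
continuity points of `γ` equals Lebesgue measure restricted to the range of `γ`. -/
theorem stmt_9 (γ : StieltjesFunction ℝ) :
    Measure.map (⇑γ) (γ.measure.restrict {t | ContinuousAt γ t}) =
      volume.restrict (Set.range ⇑γ) := by
  obtain ⟨J, hJ⟩ : ∃ J : Set ℝ, J = {y | (∃ a, γ a < y) ∧ ∃ b, y ≤ γ b} := ⟨_, rfl⟩
  obtain ⟨g, hg⟩ : ∃ g : ℝ → ℝ, ∀ y ∈ J, ∀ t, g y ≤ t ↔ y ≤ γ t := by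
    refine ⟨fun y => sInf {t | y ≤ γ t}, fun y hy t => ?_⟩
    rw [hJ] at hy
    exact gal_aux γ y hy.1 hy.2 t
  have hJo : J.OrdConnected := by
    refine ⟨fun x hx z hz y hy => ?_⟩
    rw [hJ] at hx hz ⊢
    obtain ⟨⟨a, ha⟩, -⟩ := hx
    obtain ⟨-, b, hb⟩ := hz
    exact ⟨⟨a, ha.trans_le hy.1⟩, ⟨b, hy.2.trans hb⟩⟩
  have hJm : MeasurableSet J := hJo.measurableSet
  have hgmono : MonotoneOn g J := fun x hx y hy hxy =>
    (hg x hx _).2 (hxy.trans ((hg y hy _).1 le_rfl))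
  have hgm : AEMeasurable g (volume.restrict J) :=
    aemeasurable_restrict_of_monotoneOn hJm hgmono
  have hc : {t | ¬ ContinuousAt γ t}.Countable := γ.mono.countable_not_continuousAt
  have hD : MeasurableSet {t | ContinuousAt γ t} := by
    have := hc.measurableSet.compl
    simpa [Set.compl_setOf] using this
  have hγm : Measurable γ := γ.mono.measurable
  ext A hA
  rw [Measure.map_apply hγm hA, Measure.restrict_apply (hγm hA), Measure.restrict_apply hA,
    measure_eq_aux γ g J hJ hJm hg hgm,
    Measure.map_apply_of_aemeasurable hgm ((hγm hA).inter hD), Measure.restrict_apply' hJm]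
  have key : ∀ y ∈ J, ContinuousAt γ (g y) → γ (g y) = y := by
    intro y hy hcy
    refine le_antisymm ?_ ((hg y hy _).1 le_rfl)
    have hl : Filter.Tendsto γ (nhdsWithin (g y) (Set.Iio (g y))) (nhds (γ (g y))) :=
      hcy.tendsto.mono_left nhdsWithin_le_nhds
    refine le_of_tendsto hl ?_
    filter_upwards [self_mem_nhdsWithin] with s hs
    by_contra hlt
    exact absurd ((hg y hy s).2 (not_le.1 hlt).le) (not_le.2 hs)
  have hsub : (Set.range γ \ J).Subsingleton := by
    have hle : ∀ x ∈ Set.range γ \ J, ∀ t, x ≤ γ t := by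
      rintro x ⟨⟨s, rfl⟩, hx⟩ t
      by_contra hlt
      apply hx
      rw [hJ]
      exact ⟨⟨t, not_le.1 hlt⟩, ⟨s, le_rfl⟩⟩
    intro x hx z hz
    obtain ⟨s, hs⟩ := hx.1
    obtain ⟨t, ht⟩ := hz.1
    exact le_antisymm (ht ▸ hle x hx t) (hs ▸ hle z hz s)
  have hn : volume ((Set.range γ \ J) ∪ γ '' {t | ¬ ContinuousAt γ t}) = 0 :=
    (hsub.countable.union (hc.image _)).measure_zero _
  apply le_antisymm
  · refine measure_mono ?_
    rintro y ⟨⟨h1, h2⟩, hy⟩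
    have h := key y hy h2
    refine ⟨?_, g y, h⟩
    have h1' : γ (g y) ∈ A := h1
    rwa [h] at h1'
  · refine le_trans (measure_mono (t := (g ⁻¹' (γ ⁻¹' A ∩ {t | ContinuousAt γ t}) ∩ J) ∪
      ((Set.range γ \ J) ∪ γ '' {t | ¬ ContinuousAt γ t})) ?_) ?_
    · rintro y ⟨hyA, hyr⟩
      by_cases hy : y ∈ J
      · obtain ⟨t, ht⟩ := hyr
        have h : γ (g y) = y := le_antisymm
          ((γ.mono ((hg y hy t).2 ht.ge)).trans ht.le) ((hg y hy _).1 le_rfl)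
        by_cases hcy : ContinuousAt γ (g y)
        · exact Or.inl ⟨⟨by rw [Set.mem_preimage, h]; exact hyA, hcy⟩, hy⟩
        · exact Or.inr (Or.inr ⟨g y, hcy, h⟩)
      · exact Or.inr (Or.inl ⟨hyr, hy⟩)
    · refine (measure_union_le _ _).trans ?_
      rw [hn, add_zero]
end

section
/- Let γ : ℝ → ℝ be monotone nondecreasing and right-continuous, set ν := μ_γ ↾ D_γ, and let ν = ν^a + ν^s be the Lebesgue decomposition of ν with respect to Lebesgue measure λ, where ν^a = λ.withDensity(dν/dλ) is the absolutely continuous part and ν^s is the singular part. Then there exists a Borel set E ⊆ range(γ) such that γ_# ν^a = λ ↾ E and γ_# ν^s = λ ↾ (range(γ) ∖ E). -/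
open MeasureTheory

/-- Values strictly above some value of `γ` and at most some other value. -/
def auxJ (γ : StieltjesFunction ℝ) : Set ℝ := {y | (∃ s, γ s < y) ∧ ∃ t, y ≤ γ t}

open Classical in
/-- Generalized inverse of `γ`, extended by zero. -/
noncomputable def auxQ (γ : StieltjesFunction ℝ) (y : ℝ) : ℝ :=
  if y ∈ auxJ γ then sInf {t | y ≤ γ t} else 0

lemma auxJ_meas (γ : StieltjesFunction ℝ) : MeasurableSet (auxJ γ) := by
  apply Set.OrdConnected.measurableSet
  constructor
  rintro x ⟨⟨s, hs⟩, _⟩ y ⟨_, t, ht⟩ z ⟨h1, h2⟩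
  exact ⟨⟨s, hs.trans_le h1⟩, t, h2.trans ht⟩

lemma auxQ_le (γ : StieltjesFunction ℝ) {y : ℝ} (hy : y ∈ auxJ γ) (t : ℝ) :
    auxQ γ y ≤ t ↔ y ≤ γ t := by
  obtain ⟨⟨s, hs⟩, t0, ht0⟩ := id hy
  have hb : BddBelow {t | y ≤ γ t} := by
    refine ⟨s, fun u hu => ?_⟩
    by_contra h
    have := γ.mono (not_le.1 h).le
    simp only [Set.mem_ofPred_eq] at hu
    linarith
  have hq : auxQ γ y = sInf {t | y ≤ γ t} := by simp [auxQ, hy]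
  rw [hq]
  constructor
  · intro h
    have h1 : ∀ u, t < u → y ≤ γ u := by
      intro u hu
      obtain ⟨v, hv, hvu⟩ := exists_lt_of_csInf_lt ⟨t0, ht0⟩ (h.trans_lt hu)
      exact le_trans hv (γ.mono hvu.le)
    have h2 : Filter.Tendsto γ (nhdsWithin t (Set.Ioi t)) (nhds (γ t)) :=
      (γ.right_continuous t).mono Set.Ioi_subset_Ici_self
    refine ge_of_tendsto h2 ?_
    filter_upwards [self_mem_nhdsWithin] with u hu using h1 u hu
  · intro h
    exact csInf_le hb h

lemma auxQ_meas (γ : StieltjesFunction ℝ) : Measurable (auxQ γ) := by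
  refine measurable_of_Iic fun t => ?_
  have : auxQ γ ⁻¹' Set.Iic t =
      (auxJ γ ∩ Set.Iic (γ t)) ∪ ((auxJ γ)ᶜ ∩ {_y : ℝ | 0 ≤ t}) := by
    ext y
    by_cases hy : y ∈ auxJ γ
    · simp [hy, auxQ_le γ hy]
    · simp [hy, auxQ]
  rw [this]
  exact ((auxJ_meas γ).inter measurableSet_Iic).union
    ((auxJ_meas γ).compl.inter (MeasurableSet.const _))

lemma auxQ_map (γ : StieltjesFunction ℝ) :
    (volume.restrict (auxJ γ)).map (auxQ γ) = γ.measure := by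
  symm
  refine Measure.ext_of_Ioc _ _ fun a b _ => ?_
  rw [γ.measure_Ioc, Measure.map_apply (auxQ_meas γ) measurableSet_Ioc,
    Measure.restrict_apply (auxQ_meas γ measurableSet_Ioc), ← Real.volume_Ioc]
  congr 1
  ext y
  simp only [Set.mem_Ioc, Set.mem_inter_iff, Set.mem_preimage]
  constructor
  · rintro ⟨h1, h2⟩
    have hy : y ∈ auxJ γ := ⟨⟨a, h1⟩, b, h2⟩
    refine ⟨⟨?_, (auxQ_le γ hy b).2 h2⟩, hy⟩
    rw [← not_le, auxQ_le γ hy a, not_le]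
    exact h1
  · rintro ⟨⟨h1, h2⟩, hy⟩
    rw [← not_le, auxQ_le γ hy a, not_le] at h1
    exact ⟨h1, (auxQ_le γ hy b).1 h2⟩

lemma aux_inv (γ : StieltjesFunction ℝ) {y : ℝ} (hy : y ∈ auxJ γ)
    (hc : ContinuousAt γ (auxQ γ y)) : γ (auxQ γ y) = y := by
  refine le_antisymm ?_ ((auxQ_le γ hy _).1 le_rfl)
  have h2 : Filter.Tendsto γ (nhdsWithin (auxQ γ y) (Set.Iio (auxQ γ y)))
      (nhds (γ (auxQ γ y))) := hc.tendsto.mono_left nhdsWithin_le_nhds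
  refine le_of_tendsto h2 ?_
  filter_upwards [self_mem_nhdsWithin] with u hu
  by_contra h
  exact absurd ((auxQ_le γ hy u).2 (not_le.1 h).le) (not_le.2 hu)

lemma aux_push (γ : StieltjesFunction ℝ) {S : Set ℝ} (hS : MeasurableSet S) :
    ((γ.measure.restrict {t | ContinuousAt γ t}).restrict S).map γ =
      volume.restrict (auxJ γ ∩ auxQ γ ⁻¹' ({t | ContinuousAt γ t} ∩ S)) := by
  have hD : MeasurableSet {t | ContinuousAt γ t} := measurableSet_of_continuousAt _
  ext B hB
  have hγ : Measurable γ := γ.mono.measurable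
  rw [Measure.map_apply hγ hB, Measure.restrict_restrict hS, Measure.restrict_apply (hγ hB),
    ← auxQ_map, Measure.map_apply (auxQ_meas γ) ((hγ hB).inter (hS.inter hD)),
    Measure.restrict_apply (auxQ_meas γ ((hγ hB).inter (hS.inter hD))),
    Measure.restrict_apply hB]
  congr 1
  ext y
  simp only [Set.mem_inter_iff, Set.mem_preimage, Set.mem_ofPred_eq]
  constructor
  · rintro ⟨⟨h1, h2, h3⟩, h4⟩
    rw [aux_inv γ h4 h3] at h1
    exact ⟨h1, h4, h3, h2⟩
  · rintro ⟨h1, h4, h3, h2⟩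
    refine ⟨⟨?_, h2, h3⟩, h4⟩
    rwa [aux_inv γ h4 h3]

lemma aux_countable (γ : StieltjesFunction ℝ) :
    (Set.range γ \ (auxJ γ ∩ auxQ γ ⁻¹' {t | ContinuousAt γ t})).Countable := by
  have h1 : (Set.range γ \ auxJ γ).Subsingleton := by
    rintro _ ⟨⟨s, rfl⟩, hs⟩ _ ⟨⟨t, rfl⟩, ht⟩
    refine le_antisymm ?_ ?_ <;> by_contra h
    · exact hs ⟨⟨t, not_le.1 h⟩, s, le_rfl⟩
    · exact ht ⟨⟨s, not_le.1 h⟩, t, le_rfl⟩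
  refine ((γ.mono.countable_not_continuousAt.image γ).union h1.countable).mono ?_
  rintro _ ⟨⟨t, rfl⟩, ht⟩
  by_cases hy : γ t ∈ auxJ γ
  · left
    refine ⟨auxQ γ (γ t), fun h => ht ⟨hy, h⟩, le_antisymm ?_ ?_⟩
    · exact γ.mono ((auxQ_le γ hy t).2 le_rfl)
    · exact (auxQ_le γ hy _).1 le_rfl
  · exact Or.inr ⟨⟨t, rfl⟩, hy⟩

/-- Let `γ` be a Stieltjes function (monotone nondecreasing, right continuous), and let
`ν = μ_γ ↾ D_γ` be its Lebesgue–Stieltjes measure restricted to the continuity set. If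
`ν = ν^a + ν^s` is the Lebesgue decomposition of `ν` with respect to Lebesgue measure,
then there is a Borel set `E ⊆ range γ` with `γ_# ν^a = λ ↾ E` and
`γ_# ν^s = λ ↾ (range γ ∖ E)`. -/
theorem stmt_10 (γ : StieltjesFunction ℝ) :
    ∃ E : Set ℝ, MeasurableSet E ∧ E ⊆ Set.range ⇑γ ∧
      Measure.map (⇑γ)
          (volume.withDensity
            ((γ.measure.restrict {t | ContinuousAt γ t}).rnDeriv volume)) =
        volume.restrict E ∧
      Measure.map (⇑γ)
          ((γ.measure.restrict {t | ContinuousAt γ t}).singularPart volume) =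
        volume.restrict (Set.range ⇑γ \ E) := by
  have hD : MeasurableSet {t | ContinuousAt γ t} := measurableSet_of_continuousAt _
  set ν := γ.measure.restrict {t | ContinuousAt γ t} with hν
  obtain ⟨T, hT, hT1, hT2⟩ := Measure.mutuallySingular_singularPart ν volume
  have hs : ν.singularPart volume = ν.restrict Tᶜ :=
    Measure.singularPart_eq_restrict (by rwa [compl_compl]) hT2
  have ha : volume.withDensity (ν.rnDeriv volume) = ν.restrict T := by
    conv_rhs => rw [← Measure.singularPart_add_rnDeriv ν volume]
    rw [Measure.restrict_add, Measure.restrict_eq_zero.2 hT1, zero_add,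
      Measure.restrict_eq_self_of_ae_mem]
    exact withDensity_absolutelyContinuous _ _ hT2
  have hr : ∀ y, y ∈ auxJ γ → ContinuousAt γ (auxQ γ y) → y ∈ Set.range γ :=
    fun y hy hc => ⟨_, aux_inv γ hy hc⟩
  refine ⟨auxJ γ ∩ auxQ γ ⁻¹' ({t | ContinuousAt γ t} ∩ T),
    (auxJ_meas γ).inter (auxQ_meas γ (hD.inter hT)), fun y hy => hr y hy.1 hy.2.1, ?_, ?_⟩
  · rw [ha, hν, aux_push γ hT]
  · rw [hs, hν, aux_push γ hT.compl]
    refine Measure.restrict_congr_set ?_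
    have h0 : ∀ᵐ y ∂(volume : Measure ℝ),
        y ∉ Set.range γ \ (auxJ γ ∩ auxQ γ ⁻¹' {t | ContinuousAt γ t}) :=
      measure_eq_zero_iff_ae_notMem.1 (Set.Countable.measure_zero (aux_countable γ) volume)
    filter_upwards [h0] with y hy
    apply propext
    have := hr y
    change (y ∈ auxJ γ ∧ ContinuousAt γ (auxQ γ y) ∧ auxQ γ y ∉ T) ↔
      (y ∈ Set.range γ ∧ ¬ (y ∈ auxJ γ ∧ ContinuousAt γ (auxQ γ y) ∧ auxQ γ y ∈ T))
    have hy' : ¬ (y ∈ Set.range γ ∧ ¬ (y ∈ auxJ γ ∧ ContinuousAt γ (auxQ γ y))) := hy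
    tauto
end

section
/- Area formula for monotone maps: let γ : ℝ → ℝ be monotone nondecreasing and right-continuous, and set ν := μ_γ ↾ D_γ. Then for every Borel set U ⊆ ℝ and every Lebesgue-integrable function g : ℝ → ℝ, ∫_{U ∩ range(γ)} g(x) dλ(x) = ∫_{γ⁻¹(U)} g(γ(t)) dν(t). -/
open MeasureTheory

/-- Points strictly above some value and below some value of `γ`. -/
def areaJ (γ : StieltjesFunction ℝ) : Set ℝ := {x | (∃ t, γ t < x) ∧ ∃ t, x ≤ γ t}

/-- The generalized inverse of `γ`. -/
noncomputable def areaS (γ : StieltjesFunction ℝ) (x : ℝ) : ℝ := sInf {t | x ≤ γ t}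

lemma areaS_le_iff (γ : StieltjesFunction ℝ) {x : ℝ} (hx : x ∈ areaJ γ) (t : ℝ) :
    areaS γ x ≤ t ↔ x ≤ γ t := by
  obtain ⟨⟨a, ha⟩, b, hb⟩ := hx
  have hbdd : BddBelow {t | x ≤ γ t} := by
    refine ⟨a, fun s hs => ?_⟩
    by_contra hlt
    push Not at hlt
    have := γ.mono hlt.le
    have h2 : x ≤ γ s := hs
    linarith
  constructor
  · intro h
    have hgt : ∀ s, t < s → x ≤ γ s := by
      intro s hs
      obtain ⟨u, hu, hus⟩ := exists_lt_of_csInf_lt (⟨b, hb⟩ : {t | x ≤ γ t}.Nonempty)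
        (lt_of_le_of_lt h hs)
      exact le_trans hu (γ.mono hus.le)
    have hc : Filter.Tendsto γ (nhdsWithin t (Set.Ioi t)) (nhds (γ t)) :=
      (γ.right_continuous t).mono_left (nhdsWithin_mono t Set.Ioi_subset_Ici_self)
    refine ge_of_tendsto hc ?_
    filter_upwards [self_mem_nhdsWithin] with s hs using hgt s hs
  · intro h
    exact csInf_le hbdd h

lemma measurableSet_areaJ (γ : StieltjesFunction ℝ) : MeasurableSet (areaJ γ) := by
  apply Set.OrdConnected.measurableSet
  refine ⟨?_⟩
  rintro x ⟨⟨a, ha⟩, -⟩ y ⟨-, b, hb⟩ z ⟨hxz, hzy⟩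
  exact ⟨⟨a, ha.trans_le hxz⟩, b, hzy.trans hb⟩

lemma aemeasurable_areaS (γ : StieltjesFunction ℝ) :
    AEMeasurable (areaS γ) (volume.restrict (areaJ γ)) := by
  apply aemeasurable_restrict_of_monotoneOn (measurableSet_areaJ γ)
  intro x hx y hy hxy
  rw [areaS_le_iff γ hx]
  exact hxy.trans ((areaS_le_iff γ hy _).1 le_rfl)

lemma map_areaS (γ : StieltjesFunction ℝ) :
    γ.measure = (volume.restrict (areaJ γ)).map (areaS γ) := by
  apply Measure.ext_of_Ioc
  intro a b hab
  rw [γ.measure_Ioc, Measure.map_apply_of_aemeasurable (aemeasurable_areaS γ) measurableSet_Ioc,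
    Measure.restrict_apply₀' (measurableSet_areaJ γ).nullMeasurableSet, ← Real.volume_Ioc]
  congr 1
  ext x
  constructor
  · rintro ⟨h1, h2⟩
    have hx : x ∈ areaJ γ := ⟨⟨a, h1⟩, b, h2⟩
    refine ⟨⟨?_, (areaS_le_iff γ hx b).2 h2⟩, hx⟩
    rw [← not_le, areaS_le_iff γ hx]
    exact not_le.2 h1
  · rintro ⟨⟨h1, h2⟩, hx⟩
    rw [← not_le, areaS_le_iff γ hx, not_le] at h1
    exact ⟨h1, (areaS_le_iff γ hx b).1 h2⟩

lemma area_inv (γ : StieltjesFunction ℝ) {x : ℝ} (hx : x ∈ areaJ γ)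
    (hc : ContinuousAt γ (areaS γ x)) : γ (areaS γ x) = x := by
  apply le_antisymm _ ((areaS_le_iff γ hx _).1 le_rfl)
  have hc' : Filter.Tendsto γ (nhdsWithin (areaS γ x) (Set.Iio (areaS γ x)))
      (nhds (γ (areaS γ x))) := hc.mono_left nhdsWithin_le_nhds
  refine le_of_tendsto hc' ?_
  filter_upwards [self_mem_nhdsWithin] with s hs
  by_contra hlt
  push Not at hlt
  exact absurd ((areaS_le_iff γ hx s).2 hlt.le) (not_le.2 hs)

lemma area_ae (γ : StieltjesFunction ℝ) :
    (areaS γ ⁻¹' {t | ContinuousAt γ t} ∩ areaJ γ : Set ℝ) =ᵐ[volume] Set.range γ := by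
  have hcount : (γ '' {t | ¬ ContinuousAt γ t}).Countable :=
    (γ.mono.countable_not_continuousAt).image _
  have hmin : {x : ℝ | x ∈ Set.range γ ∧ ∀ t, x ≤ γ t}.Subsingleton := by
    rintro x ⟨⟨a, rfl⟩, hx⟩ y ⟨⟨b, rfl⟩, hy⟩
    exact le_antisymm (hx b) (hy a)
  have h1 : ∀ᵐ x : ℝ, x ∉ γ '' {t | ¬ ContinuousAt γ t} :=
    measure_eq_zero_iff_ae_notMem.1 (hcount.measure_zero volume)
  have h2 : ∀ᵐ x : ℝ, x ∉ {x : ℝ | x ∈ Set.range γ ∧ ∀ t, x ≤ γ t} :=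
    measure_eq_zero_iff_ae_notMem.1 (hmin.countable.measure_zero volume)
  rw [Filter.eventuallyEq_set]
  filter_upwards [h1, h2] with x hx1 hx2
  constructor
  · rintro ⟨hc, hx⟩
    exact ⟨_, area_inv γ hx hc⟩
  · rintro ⟨t, rfl⟩
    have hJ : γ t ∈ areaJ γ := by
      refine ⟨?_, t, le_rfl⟩
      by_contra hno
      push Not at hno
      exact hx2 ⟨⟨t, rfl⟩, hno⟩
    refine ⟨?_, hJ⟩
    by_contra hc
    refine hx1 ⟨areaS γ (γ t), hc, ?_⟩
    exact le_antisymm (γ.mono ((areaS_le_iff γ hJ t).2 le_rfl))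
      ((areaS_le_iff γ hJ _).1 le_rfl)

lemma area_map (γ : StieltjesFunction ℝ) :
    (γ.measure.restrict {t | ContinuousAt γ t}).map γ = volume.restrict (Set.range γ) := by
  have hD : MeasurableSet {t | ContinuousAt γ t} := measurableSet_of_continuousAt γ
  have hS := aemeasurable_areaS γ
  have hnull : NullMeasurableSet (areaS γ ⁻¹' {t | ContinuousAt γ t})
      (volume.restrict (areaJ γ)) := hS.nullMeasurable hD
  rw [map_areaS, Measure.restrict_map_of_aemeasurable hS hD,
    AEMeasurable.map_map_of_aemeasurable γ.mono.measurable.aemeasurable hS.restrict,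
    ← Measure.restrict_congr_set (area_ae γ), ← Measure.restrict_restrict₀ hnull]
  conv_rhs => rw [← Measure.map_id (μ := (volume.restrict (areaJ γ)).restrict _)]
  apply Measure.map_congr
  have e1 := ae_restrict_mem₀ hnull
  have e2 := ae_restrict_of_ae (s := areaS γ ⁻¹' {t | ContinuousAt γ t})
    (ae_restrict_mem (μ := volume) (measurableSet_areaJ γ))
  filter_upwards [e1, e2] with x hx1 hx2
  exact area_inv γ hx2 hx1

/-- Area formula for monotone maps: for a Stieltjes function `γ` (monotone nondecreasing,
right continuous) with `ν = μ_γ ↾ D_γ` its Lebesgue–Stieltjes measure restricted to the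
continuity set, every Borel set `U ⊆ ℝ` and every Lebesgue-integrable `g : ℝ → ℝ` satisfy
`∫_{U ∩ range γ} g dλ = ∫_{γ⁻¹(U)} g(γ t) dν(t)`. -/
theorem stmt_11 (γ : StieltjesFunction ℝ) (U : Set ℝ) (hU : MeasurableSet U)
    (g : ℝ → ℝ) (hg : Integrable g volume) :
    ∫ x in U ∩ Set.range ⇑γ, g x =
      ∫ t in ⇑γ ⁻¹' U, g (γ t)
        ∂(γ.measure.restrict {t | ContinuousAt γ t}) := by
  rw [← Measure.restrict_restrict hU, ← area_map]
  refine setIntegral_map hU ?_ γ.mono.measurable.aemeasurable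
  rw [area_map]
  exact hg.aestronglyMeasurable.restrict
end
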